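/- Theorem 2 (convergence of the second-order H-EXP-D-RL scheme in monotone games): let ε > 0, γ > 0, K > 0, a > 0, consider N players with action counts n^p, n = Σ_p n^p, strategy space Δ = Π_p Δ^{n^p} ⊂ ℝⁿ, blockwise soft-max σ : ℝⁿ → ℝⁿ, and a Lipschitz continuous payoff map U : Δ → ℝⁿ such that −U is monotone on Δ, i.e., (x − x')ᵀ(U(x) − U(x')) ≤ 0 for all x, x' ∈ Δ. Assume the set {z ∈ ℝⁿ : z = U(σ(z))} is finite. Then for every differentiable solution (z, ξ) : [0, ∞) → ℝⁿ × ℝⁿ of ż(t) = γ(−z(t) + U(σ(z(t))) − K(ξ(t) + σ(z(t)))), ξ̇(t) = −aξ(t) − aσ(z(t)), there exists z̄* with z̄* = U(σ(z̄*)) such that z(t) → z̄*, ξ(t) → −σ(z̄*), and σ(z(t)) → σ(z̄*) as t → ∞. -/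

import Mathlib

open Filter

/-- The soft-max function with temperature `ε`. -/
noncomputable def softmax (ε : ℝ) {m : ℕ} (w : Fin m → ℝ) : Fin m → ℝ :=
  fun i => Real.exp (w i / ε) / ∑ j, Real.exp (w j / ε)

/-- The blockwise soft-max `σ(z) = (σ_ε(z^p))_p`. -/
noncomputable def softmaxBlk (ε : ℝ) {N : ℕ} {nAct : Fin N → ℕ}
    (z : ∀ p, Fin (nAct p) → ℝ) : ∀ p, Fin (nAct p) → ℝ :=
  fun p => softmax ε (z p)

/-- The strategy space `Δ = Π_p Δ^{n^p}`. -/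
def simplexProd (N : ℕ) (nAct : Fin N → ℕ) : Set (∀ p, Fin (nAct p) → ℝ) :=
  {x | ∀ p, (∀ i, 0 ≤ x p i) ∧ ∑ i, x p i = 1}


lemma sm_pos {ε : ℝ} {m : ℕ} (w : Fin m → ℝ) (i : Fin m) : 0 < softmax ε w i := by
  unfold softmax
  have : 0 < ∑ j, Real.exp (w j / ε) := Finset.sum_pos (fun j _ => Real.exp_pos _) ⟨i, Finset.mem_univ i⟩
  positivity

lemma se_pos {ε : ℝ} {m : ℕ} (hm : 0 < m) (w : Fin m → ℝ) : 0 < ∑ j, Real.exp (w j / ε) :=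
  Finset.sum_pos (fun j _ => Real.exp_pos _) ⟨⟨0, hm⟩, Finset.mem_univ _⟩

lemma sm_sum {ε : ℝ} {m : ℕ} (hm : 0 < m) (w : Fin m → ℝ) : ∑ i, softmax ε w i = 1 := by
  unfold softmax
  rw [← Finset.sum_div, div_self (se_pos hm w).ne']

lemma sm_le_one {ε : ℝ} {m : ℕ} (w : Fin m → ℝ) (i : Fin m) : softmax ε w i ≤ 1 := by
  have hm : 0 < m := i.pos
  rw [← sm_sum (ε := ε) hm w]
  exact Finset.single_le_sum (fun j _ => (sm_pos w j).le) (Finset.mem_univ i)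

lemma smB_mem {ε : ℝ} {N : ℕ} {nAct : Fin N → ℕ} (hn : ∀ p, 0 < nAct p)
    (z : ∀ p, Fin (nAct p) → ℝ) : softmaxBlk ε z ∈ simplexProd N nAct :=
  fun p => ⟨fun i => (sm_pos _ i).le, sm_sum (hn p) _⟩

lemma log_sm {ε : ℝ} (hε : 0 < ε) {m : ℕ} (hm : 0 < m) (w : Fin m → ℝ) (i : Fin m) :
    w i = ε * Real.log (softmax ε w i) + ε * Real.log (∑ j, Real.exp (w j / ε)) := by
  unfold softmax
  rw [Real.log_div (Real.exp_pos _).ne' (se_pos hm w).ne', Real.log_exp]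
  field_simp
  ring

lemma log_scal {x y : ℝ} (hx : 0 < x) (hx1 : x ≤ 1) (hy : 0 < y) (hy1 : y ≤ 1) :
    (x - y) ^ 2 ≤ (x - y) * (Real.log x - Real.log y) := by
  wlog h : y ≤ x generalizing x y
  · have := this hy hy1 hx hx1 (le_of_not_ge h)
    nlinarith
  have h1 : Real.log (y / x) ≤ y / x - 1 := Real.log_le_sub_one_of_pos (by positivity)
  rw [Real.log_div hy.ne' hx.ne'] at h1
  have h2 : x - y ≤ (x - y) / x := by
    rw [le_div_iff₀ hx]; nlinarith
  have h3 : (x - y) / x = 1 - y / x := by field_simp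
  nlinarith

lemma sm_strong {ε : ℝ} (hε : 0 < ε) {m : ℕ} (hm : 0 < m) (w w' : Fin m → ℝ) :
    ε * ∑ i, (softmax ε w i - softmax ε w' i) ^ 2 ≤
      ∑ i, (softmax ε w i - softmax ε w' i) * (w i - w' i) := by
  have key : ∑ i, (softmax ε w i - softmax ε w' i) * (w i - w' i) =
      ε * ∑ i, (softmax ε w i - softmax ε w' i) *
        (Real.log (softmax ε w i) - Real.log (softmax ε w' i)) := by
    have h0 : ∑ i, (softmax ε w i - softmax ε w' i) *
      (ε * Real.log (∑ j, Real.exp (w j / ε)) - ε * Real.log (∑ j, Real.exp (w' j / ε))) = 0 := by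
      rw [← Finset.sum_mul, Finset.sum_sub_distrib, sm_sum hm, sm_sum hm]; simp
    rw [← add_zero (ε * _), ← h0, Finset.mul_sum, ← Finset.sum_add_distrib]
    refine Finset.sum_congr rfl fun i _ => ?_
    have e1 := log_sm hε hm w i
    have e2 := log_sm hε hm w' i
    have e3 : w i - w' i = ε * (Real.log (softmax ε w i) - Real.log (softmax ε w' i)) +
      (ε * Real.log (∑ j, Real.exp (w j / ε)) - ε * Real.log (∑ j, Real.exp (w' j / ε))) := by
      linarith
    rw [e3]; ring
  rw [key]
  refine mul_le_mul_of_nonneg_left (Finset.sum_le_sum fun i _ => ?_) hε.le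
  exact log_scal (sm_pos _ _) (sm_le_one _ _) (sm_pos _ _) (sm_le_one _ _)

noncomputable def lse (ε : ℝ) {m : ℕ} (w : Fin m → ℝ) : ℝ := ε * Real.log (∑ j, Real.exp (w j / ε))

lemma lse_deriv {ε : ℝ} (hε : 0 < ε) {m : ℕ} (hm : 0 < m) (w : ℝ → Fin m → ℝ) (w' : Fin m → ℝ)
    (t : ℝ) (h : ∀ i, HasDerivAt (fun s => w s i) (w' i) t) :
    HasDerivAt (fun s => lse ε (w s)) (∑ i, softmax ε (w t) i * w' i) t := by
  have h1 : HasDerivAt (fun s => ∑ j, Real.exp (w s j / ε))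
      (∑ j, Real.exp (w t j / ε) * (w' j / ε)) t :=
    HasDerivAt.fun_sum fun i _ => ((h i).div_const ε).exp
  have h2 := (h1.log (se_pos hm _).ne').const_mul ε
  refine h2.congr_deriv ?_
  unfold softmax
  rw [Finset.sum_div, Finset.mul_sum]
  refine Finset.sum_congr rfl fun i _ => ?_
  have := (se_pos (ε := ε) hm (w t)).ne'
  field_simp

lemma sm_deriv {ε : ℝ} (hε : 0 < ε) {m : ℕ} (hm : 0 < m) (w : ℝ → Fin m → ℝ) (w' : Fin m → ℝ)
    (t : ℝ) (h : ∀ i, HasDerivAt (fun s => w s i) (w' i) t) (i : Fin m) :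
    HasDerivAt (fun s => softmax ε (w s) i)
      (softmax ε (w t) i * ((w' i - ∑ j, softmax ε (w t) j * w' j) / ε)) t := by
  have e : ∀ s, softmax ε (w s) i = Real.exp ((w s i - lse ε (w s)) / ε) := by
    intro s
    have := log_sm hε hm (w s) i
    have h3 : (w s i - lse ε (w s)) / ε = Real.log (softmax ε (w s) i) := by
      unfold lse; rw [div_eq_iff hε.ne']; linarith
    rw [h3, Real.exp_log (sm_pos _ _)]
  have h1 := (((h i).sub (lse_deriv hε hm w w' t h)).div_const ε).exp
  have h2 : (fun s => softmax ε (w s) i) = fun s => Real.exp ((w s i - lse ε (w s)) / ε) := funext e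
  rw [h2, e t]
  exact h1

lemma breg_nonneg {ε : ℝ} (hε : 0 < ε) {m : ℕ} (hm : 0 < m) (w w' : Fin m → ℝ) :
    0 ≤ lse ε w - lse ε w' - ∑ i, softmax ε w' i * (w i - w' i) := by
  have hj := convexOn_exp.map_sum_le (t := Finset.univ) (w := softmax ε w')
    (p := fun i => (w i - w' i) / ε) (fun i _ => (sm_pos _ _).le) (sm_sum hm _) (by simp)
  simp only [smul_eq_mul] at hj
  have e1 : ∑ i, softmax ε w' i * Real.exp ((w i - w' i) / ε) =
      (∑ j, Real.exp (w j / ε)) / ∑ j, Real.exp (w' j / ε) := by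
    rw [Finset.sum_div]
    refine Finset.sum_congr rfl fun i _ => ?_
    unfold softmax
    rw [div_mul_eq_mul_div, ← Real.exp_add]
    congr 2; ring
  rw [e1] at hj
  have h2 := Real.log_le_log (Real.exp_pos _) hj
  rw [Real.log_exp, Real.log_div (se_pos hm w).ne' (se_pos hm w').ne'] at h2
  have e2 : ∑ i, softmax ε w' i * ((w i - w' i) / ε) = (∑ i, softmax ε w' i * (w i - w' i)) / ε := by
    rw [Finset.sum_div]; exact Finset.sum_congr rfl fun i _ => by ring
  rw [e2, div_le_iff₀ hε] at h2
  unfold lse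
  linarith

lemma anti_of_deriv (H H' : ℝ → ℝ) (hd : ∀ t, 0 ≤ t → HasDerivAt H (H' t) t)
    (hn : ∀ t, 0 ≤ t → H' t ≤ 0) {s t : ℝ} (hs : 0 ≤ s) (hst : s ≤ t) : H t ≤ H s := by
  have := antitoneOn_of_deriv_nonpos (convex_Ici 0) (f := H)
    (fun t ht => (hd t ht).continuousAt.continuousWithinAt)
    (fun t ht => (hd t (interior_subset ht)).differentiableAt.differentiableWithinAt)
    (fun t ht => by rw [(hd t (interior_subset ht)).deriv]; exact hn t (interior_subset ht))
  exact this (Set.mem_Ici.2 hs) (Set.mem_Ici.2 (hs.trans hst)) hst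

lemma barbalat (W W' f : ℝ → ℝ) (C : ℝ) (hC : 0 < C) (hd : ∀ t, 0 ≤ t → HasDerivAt W (W' t) t)
    (hf0 : ∀ t, 0 ≤ t → 0 ≤ f t)
    (hW : ∀ t, 0 ≤ t → W' t ≤ - f t) (hW0 : ∀ t, 0 ≤ t → 0 ≤ W t)
    (hf : ∀ s t, 0 ≤ s → s ≤ t → |f t - f s| ≤ C * (t - s)) : Tendsto f atTop (nhds 0) := by
  have anti : ∀ s t, 0 ≤ s → s ≤ t → W t ≤ W s := fun s t hs hst =>
    anti_of_deriv W W' hd (fun t ht => by linarith [hW t ht, hf0 t ht]) hs hst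
  set I := sInf (W '' Set.Ici 0) with hI
  have hbdd : BddBelow (W '' Set.Ici 0) := ⟨0, by rintro _ ⟨t, ht, rfl⟩; exact hW0 t ht⟩
  have hIle : ∀ t, 0 ≤ t → I ≤ W t := fun t ht => csInf_le hbdd ⟨t, ht, rfl⟩
  rw [Metric.tendsto_atTop]
  intro η hη
  set δ := η / (2 * C) with hδ
  have hδ0 : 0 < δ := by positivity
  have hδC : C * δ = η / 2 := by rw [hδ]; field_simp
  obtain ⟨_, ⟨T, hT, rfl⟩, hTI⟩ := exists_lt_of_csInf_lt (s := W '' Set.Ici 0) ⟨_, 0, by simp, rfl⟩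
    (show I < I + δ * (η / 2) by linarith [mul_pos hδ0 (half_pos hη)])
  have hT : 0 ≤ T := hT
  refine ⟨T, fun t ht => ?_⟩
  have ht0 : 0 ≤ t := hT.trans ht
  rw [Real.dist_eq, sub_zero, abs_of_nonneg (hf0 t ht0)]
  by_contra! hcon
  obtain ⟨c, hc, hce⟩ := exists_hasDerivAt_eq_slope W W' (show t < t + δ by linarith)
    (fun s hs => (hd s (ht0.trans hs.1)).continuousAt.continuousWithinAt)
    (fun s hs => hd s (ht0.trans hs.1.le))
  rw [eq_div_iff (by linarith)] at hce
  have hc0 : 0 ≤ c := ht0.trans hc.1.le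
  have h1 := hW c hc0
  have h2 := abs_le.1 (hf t c ht0 hc.1.le)
  have h3 : C * (c - t) ≤ C * δ := mul_le_mul_of_nonneg_left (by linarith [hc.2]) hC.le
  have h4 : η / 2 ≤ f c := by linarith [h2.1]
  have h5 := hIle (t + δ) (by linarith)
  have h6 := anti T t hT ht
  have h7 : W' c * (t + δ - t) ≤ -(η / 2) * δ := by
    rw [add_sub_cancel_left]; exact mul_le_mul_of_nonneg_right (by linarith) hδ0.le
  linarith

lemma lin_upper (γ M t0 : ℝ) (hγ : 0 < γ) (h0 : 0 ≤ t0) (y v : ℝ → ℝ)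
    (hd : ∀ t, 0 ≤ t → HasDerivAt y (γ * (-y t + v t)) t) (hv : ∀ t, t0 ≤ t → v t ≤ M)
    (t : ℝ) (ht : t0 ≤ t) : y t ≤ M + Real.exp (-(γ * (t - t0))) * (y t0 - M) := by
  have key : Real.exp (γ * (t - t0)) * (y t - M) ≤ Real.exp (γ * (t0 - t0)) * (y t0 - M) := by
    have := anti_of_deriv (fun s => Real.exp (γ * s) * (y (s + t0) - M))
      (fun s => Real.exp (γ * s) * (γ * (v (s + t0) - M))) ?_ ?_ (le_refl 0) (sub_nonneg.2 ht)
    · simpa using this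
    · intro s hs
      have h1 : HasDerivAt (fun s : ℝ => Real.exp (γ * s)) (Real.exp (γ * s) * (γ * 1)) s :=
        ((hasDerivAt_id s).const_mul γ).exp
      have h2 : HasDerivAt (fun s => y (s + t0)) (γ * (-y (s + t0) + v (s + t0))) s :=
        (hd (s + t0) (by linarith)).comp_add_const s t0
      refine (h1.mul (h2.sub_const M)).congr_deriv ?_
      ring
    · intro s hs
      have := hv (s + t0) (by linarith)
      have h3 : γ * (v (s + t0) - M) ≤ 0 := mul_nonpos_of_nonneg_of_nonpos hγ.le (by linarith)
      exact mul_nonpos_of_nonneg_of_nonpos (Real.exp_pos _).le h3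
  rw [sub_self, mul_zero, Real.exp_zero, one_mul] at key
  have := mul_le_mul_of_nonneg_left key (Real.exp_pos (-(γ * (t - t0)))).le
  rw [← mul_assoc, ← Real.exp_add, neg_add_cancel, Real.exp_zero, one_mul] at this
  linarith

lemma lin_bdd (γ M : ℝ) (hγ : 0 < γ) (y v : ℝ → ℝ)
    (hd : ∀ t, 0 ≤ t → HasDerivAt y (γ * (-y t + v t)) t) (hv : ∀ t, 0 ≤ t → |v t| ≤ M)
    (t : ℝ) (ht : 0 ≤ t) : |y t| ≤ M + |y 0| := by
  have hM : 0 ≤ M := (abs_nonneg _).trans (hv 0 le_rfl)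
  have h1 := lin_upper γ M 0 hγ le_rfl y v hd (fun s hs => (abs_le.1 (hv s hs)).2) t ht
  have h2 := lin_upper γ M 0 hγ le_rfl (fun s => - y s) (fun s => - v s)
    (fun s hs => (hd s hs).neg.congr_deriv (by ring))
    (fun s hs => by linarith [(abs_le.1 (hv s hs)).1]) t ht
  set e := Real.exp (-(γ * (t - 0))) with he
  have e0 : 0 < e := Real.exp_pos _
  have e1 : e ≤ 1 := Real.exp_le_one_iff.2 (by rw [sub_zero]; nlinarith)
  have a1 := le_abs_self (y 0)
  have a2 := neg_abs_le (y 0)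
  have a3 := abs_nonneg (y 0)
  rw [abs_le]
  constructor <;> nlinarith

lemma lin_tendsto (γ c : ℝ) (hγ : 0 < γ) (y v : ℝ → ℝ)
    (hd : ∀ t, 0 ≤ t → HasDerivAt y (γ * (-y t + v t)) t) (hv : Tendsto v atTop (nhds c)) :
    Tendsto y atTop (nhds c) := by
  have upper : ∀ (y v : ℝ → ℝ) (c : ℝ), (∀ t, 0 ≤ t → HasDerivAt y (γ * (-y t + v t)) t) →
      Tendsto v atTop (nhds c) → ∀ η > 0, ∀ᶠ t in atTop, y t < c + η := by
    intro y v c hd hv η hη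
    have h1 : ∀ᶠ t in atTop, v t ≤ c + η / 2 :=
      (hv.eventually (gt_mem_nhds (show c < c + η / 2 by linarith))).mono fun t h => h.le
    obtain ⟨t0, ht0⟩ := eventually_atTop.1 h1
    set t1 := max t0 0
    have h2 := lin_upper γ (c + η / 2) t1 hγ (le_max_right _ _) y v hd
      (fun t ht => ht0 t ((le_max_left _ _).trans ht))
    have h3 : Tendsto (fun t => (c + η / 2) + Real.exp (-(γ * (t - t1))) * (y t1 - (c + η / 2)))
        atTop (nhds ((c + η / 2) + 0 * (y t1 - (c + η / 2)))) := by
      refine tendsto_const_nhds.add (Tendsto.mul_const _ ?_)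
      refine Real.tendsto_exp_neg_atTop_nhds_zero.comp ?_
      exact (tendsto_atTop_add_const_right _ (-t1) tendsto_id).const_mul_atTop hγ
    filter_upwards [h3.eventually (gt_mem_nhds (show _ < c + η by linarith)), eventually_ge_atTop t1]
      with t h4 h5
    exact (h2 t h5).trans_lt h4
  rw [Metric.tendsto_nhds]
  intro η hη
  filter_upwards [upper y v c hd hv η hη, upper (fun s => - y s) (fun s => - v s) (-c)
    (fun s hs => (hd s hs).neg.congr_deriv (by ring)) hv.neg η hη] with t h1 h2
  rw [Real.dist_eq, abs_lt]
  constructor <;> linarith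

noncomputable def Wf (ε γ K a : ℝ) {N : ℕ} {nAct : Fin N → ℕ} (z' z ξ : ∀ p, Fin (nAct p) → ℝ) : ℝ :=
  (1 / γ) * ∑ p, (lse ε (z p) - lse ε (z' p) - ∑ i, softmax ε (z' p) i * (z p i - z' p i)) +
    K / (2 * a) * ∑ p, ∑ i, (ξ p i + softmax ε (z' p) i) ^ 2

lemma Wf_nonneg {ε γ K a : ℝ} (hε : 0 < ε) (hγ : 0 < γ) (hK : 0 < K) (ha : 0 < a)
    {N : ℕ} {nAct : Fin N → ℕ} (hn : ∀ p, 0 < nAct p) (z' z ξ : ∀ p, Fin (nAct p) → ℝ) :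
    0 ≤ Wf ε γ K a z' z ξ := by
  unfold Wf
  have h1 : 0 ≤ ∑ p, (lse ε (z p) - lse ε (z' p) - ∑ i, softmax ε (z' p) i * (z p i - z' p i)) :=
    Finset.sum_nonneg fun p _ => breg_nonneg hε (hn p) _ _
  have h2 : 0 ≤ ∑ p, ∑ i, (ξ p i + softmax ε (z' p) i) ^ 2 :=
    Finset.sum_nonneg fun p _ => Finset.sum_nonneg fun i _ => sq_nonneg _
  positivity

lemma Wf_deriv {ε γ K a : ℝ} (hε : 0 < ε) (hγ : 0 < γ) (ha : 0 < a)
    {N : ℕ} {nAct : Fin N → ℕ} (hn : ∀ p, 0 < nAct p)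
    (U : (∀ p, Fin (nAct p) → ℝ) → ∀ p, Fin (nAct p) → ℝ)
    (z ξ : ℝ → ∀ p, Fin (nAct p) → ℝ) (t : ℝ)
    (hz : ∀ p, ∀ i,
      HasDerivAt (fun s => z s p i)
        (γ * (-z t p i + U (softmaxBlk ε (z t)) p i -
          K * (ξ t p i + softmaxBlk ε (z t) p i))) t)
    (hξ : ∀ p, ∀ i,
      HasDerivAt (fun s => ξ s p i) (-a * ξ t p i - a * softmaxBlk ε (z t) p i) t)
    (z' : ∀ p, Fin (nAct p) → ℝ) :
    HasDerivAt (fun s => Wf ε γ K a z' (z s) (ξ s))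
      (∑ p, ∑ i, ((softmaxBlk ε (z t) p i - softmaxBlk ε z' p i) *
        (-z t p i + U (softmaxBlk ε (z t)) p i) - K * (ξ t p i + softmaxBlk ε (z t) p i) ^ 2)) t := by
  unfold Wf
  have h1 : HasDerivAt (fun s => ∑ p, (lse ε (z s p) - lse ε (z' p) -
      ∑ i, softmax ε (z' p) i * (z s p i - z' p i))) _ t :=
    HasDerivAt.fun_sum fun p _ => ((lse_deriv hε (hn p) (fun s => z s p) _ t (hz p)).sub_const _).sub
      (HasDerivAt.fun_sum fun i _ => ((hz p i).sub_const (z' p i)).const_mul (softmax ε (z' p) i))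
  have h2 : HasDerivAt (fun s => ∑ p, ∑ i, (ξ s p i + softmax ε (z' p) i) ^ 2) _ t :=
    HasDerivAt.fun_sum fun p _ => HasDerivAt.fun_sum fun i _ =>
      ((hξ p i).add_const (softmax ε (z' p) i)).fun_pow 2
  refine ((h1.const_mul (1 / γ)).add (h2.const_mul (K / (2 * a)))).congr_deriv ?_
  simp only [← Finset.sum_sub_distrib]
  simp only [Finset.mul_sum, ← Finset.sum_add_distrib]
  refine Finset.sum_congr rfl fun p _ => Finset.sum_congr rfl fun i _ => ?_
  simp only [softmaxBlk]
  field_simp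
  push_cast
  ring

lemma Wf_bound {ε K : ℝ} (hε : 0 < ε) (hK : 0 < K)
    {N : ℕ} {nAct : Fin N → ℕ} (hn : ∀ p, 0 < nAct p)
    (U : (∀ p, Fin (nAct p) → ℝ) → ∀ p, Fin (nAct p) → ℝ)
    (hU_mono : ∀ x ∈ simplexProd N nAct, ∀ x' ∈ simplexProd N nAct,
      ∑ p, ∑ i, (x p i - x' p i) * (U x p i - U x' p i) ≤ 0)
    (z ξ z' : ∀ p, Fin (nAct p) → ℝ) :
    (∑ p, ∑ i, ((softmaxBlk ε z p i - softmaxBlk ε z' p i) *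
        (-z p i + U (softmaxBlk ε z) p i) - K * (ξ p i + softmaxBlk ε z p i) ^ 2)) ≤
    (∑ p, ∑ i, (softmaxBlk ε z p i - softmaxBlk ε z' p i) * (U (softmaxBlk ε z') p i - z' p i))
     - ε * ∑ p, ∑ i, (softmaxBlk ε z p i - softmaxBlk ε z' p i) ^ 2 := by
  have h1 := hU_mono _ (smB_mem (ε := ε) hn z) _ (smB_mem (ε := ε) hn z')
  have h2 : ε * ∑ p, ∑ i, (softmaxBlk ε z p i - softmaxBlk ε z' p i) ^ 2 ≤
      ∑ p, ∑ i, (softmaxBlk ε z p i - softmaxBlk ε z' p i) * (z p i - z' p i) := by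
    rw [Finset.mul_sum]
    exact Finset.sum_le_sum fun p _ => sm_strong hε (hn p) _ _
  have h3 : 0 ≤ ∑ p, ∑ i, K * (ξ p i + softmaxBlk ε z p i) ^ 2 :=
    Finset.sum_nonneg fun p _ => Finset.sum_nonneg fun i _ => by positivity
  have h4 : (∑ p, ∑ i, ((softmaxBlk ε z p i - softmaxBlk ε z' p i) *
        (-z p i + U (softmaxBlk ε z) p i) - K * (ξ p i + softmaxBlk ε z p i) ^ 2)) =
    (∑ p, ∑ i, (softmaxBlk ε z p i - softmaxBlk ε z' p i) * (U (softmaxBlk ε z') p i - z' p i))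
    + (∑ p, ∑ i, (softmaxBlk ε z p i - softmaxBlk ε z' p i) *
       (U (softmaxBlk ε z) p i - U (softmaxBlk ε z') p i))
    - (∑ p, ∑ i, (softmaxBlk ε z p i - softmaxBlk ε z' p i) * (z p i - z' p i))
    - ∑ p, ∑ i, K * (ξ p i + softmaxBlk ε z p i) ^ 2 := by
    simp only [← Finset.sum_sub_distrib, ← Finset.sum_add_distrib]
    refine Finset.sum_congr rfl fun p _ => Finset.sum_congr rfl fun i _ => ?_
    ring
  linarith

lemma simplex_compact (N : ℕ) (nAct : Fin N → ℕ) : IsCompact (simplexProd N nAct) := by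
  have hb : IsCompact (Set.Icc (0 : ∀ p, Fin (nAct p) → ℝ) 1) := isCompact_Icc
  refine hb.of_isClosed_subset ?_ ?_
  · have : simplexProd N nAct = ⋂ p, ((⋂ i, {x : ∀ p, Fin (nAct p) → ℝ | 0 ≤ x p i}) ∩
        {x | ∑ i, x p i = 1}) := by
      ext x; simp [simplexProd]
    rw [this]
    refine isClosed_iInter fun p => IsClosed.inter (isClosed_iInter fun i => ?_) ?_
    · exact isClosed_le continuous_const (by fun_prop)
    · exact isClosed_eq (by fun_prop) continuous_const
  · intro x hx
    refine ⟨fun p i => (hx p).1 i, fun p i => ?_⟩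
    show x p i ≤ 1
    rw [← (hx p).2]
    exact Finset.single_le_sum (fun j _ => (hx p).1 j) (Finset.mem_univ i)

/-- Minty implies Stampacchia, giving a logit equilibrium. -/
lemma minty {ε : ℝ} (hε : 0 < ε)
    {N : ℕ} {nAct : Fin N → ℕ} (hn : ∀ p, 0 < nAct p)
    (U : (∀ p, Fin (nAct p) → ℝ) → ∀ p, Fin (nAct p) → ℝ)
    (hU : ContinuousOn U (simplexProd N nAct)) (x : ∀ p, Fin (nAct p) → ℝ)
    (hx : x ∈ simplexProd N nAct)
    (hM : ∀ z', 0 ≤ ∑ p, ∑ i, (x p i - softmaxBlk ε z' p i) * (U (softmaxBlk ε z') p i - z' p i)) :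
    softmaxBlk ε (U x) = x := by
  set y := softmaxBlk ε (U x) with hy
  have hypos : ∀ p i, 0 < y p i := fun p i => sm_pos _ _
  have hymem : y ∈ simplexProd N nAct := smB_mem hn _
  let xs : ℝ → ∀ p, Fin (nAct p) → ℝ := fun s p i => x p i + s * (y p i - x p i)
  have hxspos : ∀ s, 0 < s → s ≤ 1 → ∀ p i, 0 < xs s p i := by
    intro s hs hs1 p i
    show 0 < x p i + s * (y p i - x p i)
    have := (hx p).1 i
    have := mul_pos hs (hypos p i)
    nlinarith
  have hxssum : ∀ s p, ∑ i, xs s p i = 1 := by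
    intro s p
    show ∑ i, (x p i + s * (y p i - x p i)) = 1
    rw [Finset.sum_add_distrib, ← Finset.mul_sum, Finset.sum_sub_distrib, (hx p).2, (hymem p).2]
    ring
  have hsm : ∀ s, 0 < s → s ≤ 1 →
      softmaxBlk ε (fun p i => ε * Real.log (xs s p i)) = xs s := by
    intro s hs hs1
    funext p i
    simp only [softmaxBlk, softmax]
    have : ∀ j, Real.exp (ε * Real.log (xs s p j) / ε) = xs s p j := by
      intro j
      rw [mul_div_cancel_left₀ _ hε.ne', Real.exp_log (hxspos s hs hs1 p j)]
    simp only [this, hxssum, div_one]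
  set c := ε * ∑ p, ∑ i, (x p i - y p i) * (Real.log (xs (1/2) p i) - Real.log (y p i)) with hc
  -- main inequality
  have main : ∀ s, 0 < s → s ≤ 1/2 →
      c ≤ ∑ p, ∑ i, (x p i - y p i) * (U (xs s) p i - U x p i) := by
    intro s hs hs1
    have h0 := hM (fun p i => ε * Real.log (xs s p i))
    rw [hsm s hs (by linarith)] at h0
    have h1 : ∑ p, ∑ i, (x p i - xs s p i) * (U (xs s) p i - ε * Real.log (xs s p i)) =
        s * ∑ p, ∑ i, (x p i - y p i) * (U (xs s) p i - ε * Real.log (xs s p i)) := by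
      simp only [Finset.mul_sum]
      refine Finset.sum_congr rfl fun p _ => Finset.sum_congr rfl fun i _ => ?_
      simp only [xs]; ring
    rw [h1] at h0
    have h2 := nonneg_of_mul_nonneg_right h0 hs
    have h3 : ∑ p, ∑ i, (x p i - y p i) * (U x p i - ε * Real.log (y p i)) = 0 := by
      refine Finset.sum_eq_zero fun p _ => ?_
      have : ∀ i, U x p i - ε * Real.log (y p i) =
          ε * Real.log (∑ j, Real.exp (U x p j / ε)) := fun i => by
        have := log_sm hε (hn p) (U x p) i
        simp only [hy, softmaxBlk]
        linarith
      simp only [this]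
      rw [← Finset.sum_mul, Finset.sum_sub_distrib, (hx p).2, (hymem p).2]; simp
    have h4 : c ≤ ε * ∑ p, ∑ i, (x p i - y p i) * (Real.log (xs s p i) - Real.log (y p i)) := by
      rw [hc]
      refine mul_le_mul_of_nonneg_left (Finset.sum_le_sum fun p _ => Finset.sum_le_sum fun i _ => ?_)
        hε.le
      have p1 := hxspos s hs (by linarith) p i
      have p2 := hxspos (1/2) (by norm_num) (by norm_num) p i
      rcases le_total (x p i) (y p i) with h | h
      · have : Real.log (xs s p i) ≤ Real.log (xs (1/2) p i) :=
          Real.log_le_log p1 (by simp only [xs]; nlinarith)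
        nlinarith
      · have : Real.log (xs (1/2) p i) ≤ Real.log (xs s p i) :=
          Real.log_le_log p2 (by simp only [xs]; nlinarith)
        nlinarith
    have h5 : ∑ p, ∑ i, (x p i - y p i) * (U (xs s) p i - U x p i) =
       ∑ p, ∑ i, (x p i - y p i) * (U (xs s) p i - ε * Real.log (xs s p i)) +
       ε * ∑ p, ∑ i, (x p i - y p i) * (Real.log (xs s p i) - Real.log (y p i)) -
       ∑ p, ∑ i, (x p i - y p i) * (U x p i - ε * Real.log (y p i)) := by
      simp only [Finset.mul_sum, ← Finset.sum_sub_distrib, ← Finset.sum_add_distrib]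
      refine Finset.sum_congr rfl fun p _ => Finset.sum_congr rfl fun i _ => ?_
      ring
    linarith
  have hcle : c ≤ 0 := by
    have hxs0 : Tendsto xs (nhdsWithin 0 (Set.Ioc 0 (1/2))) (nhdsWithin x (simplexProd N nAct)) := by
      refine tendsto_nhdsWithin_iff.2 ⟨?_, ?_⟩
      · have hcont : Continuous xs := by
          refine continuous_pi fun p => continuous_pi fun i => ?_
          simp only [xs]; fun_prop
        have : xs 0 = x := by funext p i; simp [xs]
        have h := hcont.tendsto 0
        rw [this] at h
        exact h.mono_left nhdsWithin_le_nhds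
      · filter_upwards [self_mem_nhdsWithin] with s hs
        exact fun p => ⟨fun i => (hxspos s hs.1 (by linarith [hs.2]) p i).le, hxssum s p⟩
    have hUt : Tendsto (fun s => U (xs s)) (nhdsWithin 0 (Set.Ioc 0 (1/2))) (nhds (U x)) :=
      (hU x hx).tendsto.comp hxs0
    have hlim : Tendsto (fun s => ∑ p, ∑ i, (x p i - y p i) * (U (xs s) p i - U x p i))
        (nhdsWithin 0 (Set.Ioc 0 (1/2))) (nhds (∑ p, ∑ i, (x p i - y p i) * (U x p i - U x p i))) := by
      refine tendsto_finsetSum _ fun p _ => tendsto_finsetSum _ fun i _ => ?_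
      refine Tendsto.const_mul _ (Tendsto.sub_const ?_ _)
      exact tendsto_pi_nhds.1 (tendsto_pi_nhds.1 hUt p) i
    simp only [sub_self, mul_zero, Finset.sum_const_zero] at hlim
    have hne : (nhdsWithin (0:ℝ) (Set.Ioc 0 (1/2))).NeBot := by
      rw [nhdsWithin_Ioc_eq_nhdsGT (by norm_num)]; infer_instance
    refine ge_of_tendsto hlim ?_
    filter_upwards [self_mem_nhdsWithin] with s hs
    exact main s hs.1 hs.2
  -- each term of c is at least 2 * (difference)^2
  have hterm : ∀ p i, (1/2) * (x p i - y p i) ^ 2 ≤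
      (x p i - y p i) * (Real.log (xs (1/2) p i) - Real.log (y p i)) := by
    intro p i
    have p2 := hxspos (1/2) (by norm_num) (by norm_num) p i
    have le1 : xs (1/2) p i ≤ 1 := by
      refine le_of_le_of_eq ?_ (hxssum (1/2) p)
      exact Finset.single_le_sum (fun j _ => (hxspos (1/2) (by norm_num) (by norm_num) p j).le)
        (Finset.mem_univ i)
    have := log_scal p2 le1 (hypos p i) (sm_le_one _ _)
    have e : xs (1/2) p i - y p i = (1/2) * (x p i - y p i) := by simp only [xs]; ring
    rw [e] at this
    nlinarith
  have hsum : ∑ p, ∑ i, (1/2) * (x p i - y p i) ^ 2 ≤ 0 := by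
    refine (Finset.sum_le_sum fun p _ => Finset.sum_le_sum fun i _ => hterm p i).trans ?_
    exact nonpos_of_mul_nonpos_right hcle hε
  funext p i
  have h1 := Finset.single_le_sum (f := fun p => ∑ i, (1/2) * (x p i - y p i) ^ 2)
    (fun p _ => Finset.sum_nonneg fun i _ => by positivity) (Finset.mem_univ p)
  have h2 := Finset.single_le_sum (f := fun i => (1/2) * (x p i - y p i) ^ 2)
    (fun i _ => by positivity) (Finset.mem_univ i)
  have h3 : (x p i - y p i) ^ 2 ≤ 0 := by
    have := h2.trans (h1.trans hsum)
    linarith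
  have h4 : x p i - y p i = 0 := pow_eq_zero_iff (two_ne_zero) |>.1 (le_antisymm h3 (sq_nonneg _))
  linarith

lemma exists_logit_eq {ε γ K a : ℝ} (hε : 0 < ε) (hγ : 0 < γ)
    (hK : 0 < K) (ha : 0 < a)
    {N : ℕ} {nAct : Fin N → ℕ} (hn : ∀ p, 0 < nAct p)
    (U : (∀ p, Fin (nAct p) → ℝ) → ∀ p, Fin (nAct p) → ℝ)
    (hU : ContinuousOn U (simplexProd N nAct))
    (hU_mono : ∀ x ∈ simplexProd N nAct, ∀ x' ∈ simplexProd N nAct,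
      ∑ p, ∑ i, (x p i - x' p i) * (U x p i - U x' p i) ≤ 0)
    (z ξ : ℝ → ∀ p, Fin (nAct p) → ℝ)
    (hz : ∀ t, 0 ≤ t → ∀ p, ∀ i,
      HasDerivAt (fun s => z s p i)
        (γ * (-z t p i + U (softmaxBlk ε (z t)) p i -
          K * (ξ t p i + softmaxBlk ε (z t) p i))) t)
    (hξ : ∀ t, 0 ≤ t → ∀ p, ∀ i,
      HasDerivAt (fun s => ξ s p i) (-a * ξ t p i - a * softmaxBlk ε (z t) p i) t) :
    ∃ zs, U (softmaxBlk ε zs) = zs := by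
  let g : ℝ → ∀ p, Fin (nAct p) → ℝ := fun t => softmaxBlk ε (z (max t 0))
  have hgc : ∀ p i, Continuous (fun t => g t p i) := by
    intro p i
    have h1 : ContinuousOn (fun t => softmaxBlk ε (z t) p i) (Set.Ici 0) := fun t ht =>
      (sm_deriv hε (hn p) (fun s => z s p) _ t (hz t ht p) i).continuousAt.continuousWithinAt
    exact h1.comp_continuous (by fun_prop : Continuous fun t : ℝ => max t 0) (fun t => Set.mem_Ici.2 (le_max_right _ _))
  let X : ℝ → ∀ p, Fin (nAct p) → ℝ := fun t p i => ∫ s in (0:ℝ)..t, g s p i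
  have hXd : ∀ p i t, HasDerivAt (fun t => X t p i) (g t p i) t := fun p i t =>
    intervalIntegral.integral_hasDerivAt_right ((hgc p i).intervalIntegrable _ _)
      ((hgc p i).stronglyMeasurableAtFilter _ _) (hgc p i).continuousAt
  have hX0 : ∀ p i, X 0 p i = 0 := fun p i => intervalIntegral.integral_same
  have hXnn : ∀ t, 0 ≤ t → ∀ p i, 0 ≤ X t p i := fun t ht p i =>
    intervalIntegral.integral_nonneg ht fun s _ => (sm_pos _ _).le
  have hXsum : ∀ t p, ∑ i, X t p i = t := by
    intro t p
    show ∑ i, ∫ s in (0:ℝ)..t, g s p i = t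
    rw [← intervalIntegral.integral_finsetSum fun i _ => (hgc p i).intervalIntegrable _ _]
    have : ∀ s, ∑ i, g s p i = 1 := fun s => sm_sum (hn p) _
    simp [this]
  let m : ℕ → ∀ p, Fin (nAct p) → ℝ := fun n p i => X (n + 1) p i / (n + 1)
  have hm : ∀ n, m n ∈ simplexProd N nAct := by
    intro n p
    refine ⟨fun i => div_nonneg (hXnn _ (by positivity) p i) (by positivity), ?_⟩
    show ∑ i, X (n + 1) p i / ((n:ℝ) + 1) = 1
    rw [← Finset.sum_div, hXsum, div_self (by positivity)]
  obtain ⟨xh, hxh, φ, hφ, hlim⟩ := (simplex_compact N nAct).tendsto_subseq hm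
  refine ⟨U xh, ?_⟩
  rw [minty hε hn U hU xh hxh]
  intro z'
  set x' := softmaxBlk ε z' with hx'
  set c : ∀ p, Fin (nAct p) → ℝ := fun p i => U x' p i - z' p i with hc
  show 0 ≤ ∑ p, ∑ i, (xh p i - x' p i) * c p i
  have hineq : ∀ t, 0 ≤ t → Wf ε γ K a z' (z t) (ξ t) - ∑ p, ∑ i, (X t p i - t * x' p i) * c p i ≤
      Wf ε γ K a z' (z 0) (ξ 0) := by
    intro t ht
    have := anti_of_deriv
      (fun t => Wf ε γ K a z' (z t) (ξ t) - ∑ p, ∑ i, (X t p i - t * x' p i) * c p i)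
      (fun t => (∑ p, ∑ i, ((softmaxBlk ε (z t) p i - softmaxBlk ε z' p i) *
        (-z t p i + U (softmaxBlk ε (z t)) p i) - K * (ξ t p i + softmaxBlk ε (z t) p i) ^ 2))
        - ∑ p, ∑ i, (g t p i - 1 * x' p i) * c p i) ?_ ?_ le_rfl ht
    · simpa [hX0] using this
    · intro t ht
      refine (Wf_deriv hε hγ ha hn U z ξ t (hz t ht) (hξ t ht) z').sub ?_
      exact HasDerivAt.fun_sum fun p _ => HasDerivAt.fun_sum fun i _ =>
        ((hXd p i t).sub ((hasDerivAt_id t).mul_const (x' p i))).mul_const (c p i)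
    · intro t ht
      have h1 := Wf_bound hε hK hn U hU_mono (z t) (ξ t) z'
      have h2 : 0 ≤ ε * ∑ p, ∑ i, (softmaxBlk ε (z t) p i - softmaxBlk ε z' p i) ^ 2 :=
        mul_nonneg hε.le (Finset.sum_nonneg fun p _ => Finset.sum_nonneg fun i _ => sq_nonneg _)
      have h3 : g t = softmaxBlk ε (z t) := by simp only [g, max_eq_left ht]
      simp only [h3, one_mul]
      linarith
  have hn' : ∀ n : ℕ, -(Wf ε γ K a z' (z 0) (ξ 0) * (1 / ((n:ℝ) + 1))) ≤
      ∑ p, ∑ i, (m n p i - x' p i) * c p i := by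
    intro n
    have hp : (0:ℝ) < (n:ℝ) + 1 := by positivity
    have h1 := hineq ((n:ℝ) + 1) hp.le
    have h2 := Wf_nonneg hε hγ hK ha hn z' (z ((n:ℝ) + 1)) (ξ ((n:ℝ) + 1))
    have h3 : ∑ p, ∑ i, (m n p i - x' p i) * c p i =
        (∑ p, ∑ i, (X ((n:ℝ) + 1) p i - ((n:ℝ) + 1) * x' p i) * c p i) * (1 / ((n:ℝ) + 1)) := by
      simp only [Finset.sum_mul]
      refine Finset.sum_congr rfl fun p _ => Finset.sum_congr rfl fun i _ => ?_
      simp only [m]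
      field_simp
    rw [h3, ← neg_mul]
    exact mul_le_mul_of_nonneg_right (by linarith) (by positivity)
  have l1 : Tendsto (fun n : ℕ => -(Wf ε γ K a z' (z 0) (ξ 0) * (1 / ((n:ℝ) + 1)))) atTop
      (nhds (-(Wf ε γ K a z' (z 0) (ξ 0) * 0))) :=
    (tendsto_one_div_add_atTop_nhds_zero_nat.const_mul _).neg
  simp only [mul_zero, neg_zero] at l1
  have l2 : Tendsto (fun n => ∑ p, ∑ i, (m (φ n) p i - x' p i) * c p i) atTop
      (nhds (∑ p, ∑ i, (xh p i - x' p i) * c p i)) :=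
    tendsto_finsetSum _ fun p _ => tendsto_finsetSum _ fun i _ =>
      ((tendsto_pi_nhds.1 (tendsto_pi_nhds.1 hlim p) i).sub_const _).mul_const _
  exact le_of_tendsto_of_tendsto' (l1.comp hφ.tendsto_atTop) l2 fun n => hn' (φ n)

/-- Theorem 2 (convergence of the second-order H-EXP-D-RL scheme in monotone
games): if `−U` is monotone on `Δ`, `U` is Lipschitz on `Δ`, and the fixed points
of `z ↦ U(σ(z))` are finitely many, then every solution of
`ż = γ(−z + U(σ(z)) − K(ξ + σ(z)))`, `ξ̇ = −aξ − aσ(z)` on `[0, ∞)` satisfies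
`z(t) → z̄*`, `ξ(t) → −σ(z̄*)`, `σ(z(t)) → σ(z̄*)` for some `z̄* = U(σ(z̄*))`. -/
theorem hexpdrl_convergence_monotone (ε γ K a : ℝ) (hε : 0 < ε) (hγ : 0 < γ)
    (hK : 0 < K) (ha : 0 < a)
    (N : ℕ) (nAct : Fin N → ℕ) (hn : ∀ p, 0 < nAct p)
    (U : (∀ p, Fin (nAct p) → ℝ) → ∀ p, Fin (nAct p) → ℝ)
    (L : NNReal) (hU_lip : LipschitzOnWith L U (simplexProd N nAct))
    (hU_mono : ∀ x ∈ simplexProd N nAct, ∀ x' ∈ simplexProd N nAct,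
      ∑ p, ∑ i, (x p i - x' p i) * (U x p i - U x' p i) ≤ 0)
    (hfin : {w : ∀ p, Fin (nAct p) → ℝ | U (softmaxBlk ε w) = w}.Finite)
    (z ξ : ℝ → ∀ p, Fin (nAct p) → ℝ)
    (hz : ∀ t, 0 ≤ t → ∀ p, ∀ i,
      HasDerivAt (fun s => z s p i)
        (γ * (-z t p i + U (softmaxBlk ε (z t)) p i -
          K * (ξ t p i + softmaxBlk ε (z t) p i))) t)
    (hξ : ∀ t, 0 ≤ t → ∀ p, ∀ i,
      HasDerivAt (fun s => ξ s p i) (-a * ξ t p i - a * softmaxBlk ε (z t) p i) t) :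
    ∃ zs, U (softmaxBlk ε zs) = zs ∧
      Tendsto z atTop (nhds zs) ∧
      Tendsto ξ atTop (nhds (-softmaxBlk ε zs)) ∧
      Tendsto (fun t => softmaxBlk ε (z t)) atTop (nhds (softmaxBlk ε zs)) := by
  have hUc : ContinuousOn U (simplexProd N nAct) := hU_lip.continuousOn
  obtain ⟨zs, hzs⟩ := exists_logit_eq hε hγ hK ha hn U hUc hU_mono z ξ hz hξ
  refine ⟨zs, hzs, ?_⟩
  have hmem : ∀ w, softmaxBlk ε w ∈ simplexProd N nAct := fun w => smB_mem hn w
  have hx0 : ∀ (w : ∀ p, Fin (nAct p) → ℝ) p i, 0 < softmaxBlk ε w p i := fun w p i => sm_pos _ _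
  have hx1 : ∀ (w : ∀ p, Fin (nAct p) → ℝ) p i, softmaxBlk ε w p i ≤ 1 := fun w p i => sm_le_one _ _
  have hξd : ∀ p i t, 0 ≤ t →
      HasDerivAt (fun s => ξ s p i) (a * (-ξ t p i + -softmaxBlk ε (z t) p i)) t :=
    fun p i t ht => (hξ t ht p i).congr_deriv (by ring)
  have hzd : ∀ p i t, 0 ≤ t →
      HasDerivAt (fun s => z s p i) (γ * (-z t p i + (U (softmaxBlk ε (z t)) p i -
          K * (ξ t p i + softmaxBlk ε (z t) p i)))) t :=
    fun p i t ht => (hz t ht p i).congr_deriv (by ring)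
  have hξb : ∀ p i t, 0 ≤ t → |ξ t p i| ≤ 1 + |ξ 0 p i| := fun p i =>
    lin_bdd a 1 ha _ _ (hξd p i) fun t _ => by
      rw [abs_neg, abs_of_pos (hx0 _ _ _)]; exact hx1 _ _ _
  have hUb : ∃ B, ∀ w p i, |U (softmaxBlk ε w) p i| ≤ B := by
    obtain ⟨B, hB⟩ := ((simplex_compact N nAct).image_of_continuousOn hUc).isBounded.exists_norm_le
    refine ⟨B, fun w p i => ?_⟩
    have h1 := hB _ ⟨_, hmem w, rfl⟩
    exact ((norm_le_pi_norm (U (softmaxBlk ε w) p) i).trans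
      (norm_le_pi_norm (U (softmaxBlk ε w)) p)).trans h1
  obtain ⟨B, hB⟩ := hUb
  -- bound on the driving term and on the derivative
  have hvb : ∀ p i t, 0 ≤ t → |U (softmaxBlk ε (z t)) p i -
      K * (ξ t p i + softmaxBlk ε (z t) p i)| ≤ B + K * (2 + |ξ 0 p i|) := by
    intro p i t ht
    have h1 := hB (z t) p i
    have h2 := hξb p i t ht
    have h3 : |ξ t p i + softmaxBlk ε (z t) p i| ≤ 2 + |ξ 0 p i| := by
      have := abs_add_le (ξ t p i) (softmaxBlk ε (z t) p i)
      rw [abs_of_pos (hx0 (z t) p i)] at this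
      linarith [hx1 (z t) p i]
    have h4 := abs_sub (U (softmaxBlk ε (z t)) p i) (K * (ξ t p i + softmaxBlk ε (z t) p i))
    rw [abs_mul, abs_of_pos hK] at h4
    have h5 := mul_le_mul_of_nonneg_left h3 hK.le
    linarith
  have hzb : ∀ p i t, 0 ≤ t → |z t p i| ≤ B + K * (2 + |ξ 0 p i|) + |z 0 p i| := fun p i =>
    lin_bdd γ _ hγ _ _ (hzd p i) (hvb p i)
  let D0 : ∀ p, Fin (nAct p) → ℝ := fun p i =>
    γ * ((B + K * (2 + |ξ 0 p i|) + |z 0 p i|) + (B + K * (2 + |ξ 0 p i|)))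
  have hD0 : ∀ p i t, 0 ≤ t → |γ * (-z t p i + U (softmaxBlk ε (z t)) p i -
          K * (ξ t p i + softmaxBlk ε (z t) p i))| ≤ D0 p i := by
    intro p i t ht
    rw [abs_mul, abs_of_pos hγ, add_sub_assoc]
    refine mul_le_mul_of_nonneg_left ?_ hγ.le
    refine (abs_add_le _ _).trans (add_le_add ?_ (hvb p i t ht))
    rw [abs_neg]; exact hzb p i t ht
  -- convergence of the strategies
  have hxlim : ∀ p i, Tendsto (fun t => softmaxBlk ε (z t) p i) atTop
      (nhds (softmaxBlk ε zs p i)) := by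
    intro p i
    let f : ℝ → ℝ := fun t => ε * (softmaxBlk ε (z t) p i - softmaxBlk ε zs p i) ^ 2
    set D := D0 p i + ∑ j, D0 p j with hD
    have hD0nn : ∀ j, 0 ≤ D0 p j := fun j => (abs_nonneg _).trans (hD0 p j 0 le_rfl)
    have hDnn : 0 ≤ D := add_nonneg (hD0nn i) (Finset.sum_nonneg fun j _ => hD0nn j)
    have hfd : ∀ t, 0 ≤ t → ∃ f', HasDerivAt f f' t ∧ |f'| ≤ 2 * D + 1 := by
      intro t ht
      have h1 := sm_deriv hε (hn p) (fun s => z s p) _ t (hz t ht p) i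
      refine ⟨_, ((h1.sub_const (softmaxBlk ε zs p i)).fun_pow 2).const_mul ε, ?_⟩
      set q := ∑ j, softmax ε (z t p) j * (γ * (-z t p j + U (softmaxBlk ε (z t)) p j -
          K * (ξ t p j + softmaxBlk ε (z t) p j))) with hq
      have hqb : |q| ≤ ∑ j, D0 p j := by
        refine (Finset.abs_sum_le_sum_abs _ _).trans (Finset.sum_le_sum fun j _ => ?_)
        rw [abs_mul, abs_of_pos (sm_pos _ _)]
        calc _ ≤ 1 * D0 p j := mul_le_mul (sm_le_one _ _) (hD0 p j t ht) (abs_nonneg _) zero_le_one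
          _ = _ := one_mul _
      set r := γ * (-z t p i + U (softmaxBlk ε (z t)) p i -
          K * (ξ t p i + softmaxBlk ε (z t) p i)) with hr
      have hrb : |r| ≤ D0 p i := hD0 p i t ht
      have hrq : |r - q| ≤ D := (abs_sub _ _).trans (add_le_add hrb hqb)
      have e : ε * ((2:ℕ) * (softmax ε (z t p) i - softmaxBlk ε zs p i) ^ (2 - 1) *
          (softmax ε (z t p) i * ((r - q) / ε))) =
          2 * ((softmax ε (z t p) i - softmaxBlk ε zs p i) * softmax ε (z t p) i) * (r - q) := by
        field_simp
        push_cast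
        ring
      have e2 : |(softmax ε (z t p) i - softmaxBlk ε zs p i) * softmax ε (z t p) i| ≤ 1 := by
        have b1 := sm_pos (ε := ε) (z t p) i
        have b2 := sm_le_one (ε := ε) (z t p) i
        have b3 := hx0 zs p i
        have b4 := hx1 zs p i
        rw [abs_mul, abs_of_pos b1]
        have : |softmax ε (z t p) i - softmaxBlk ε zs p i| ≤ 1 := by
          rw [abs_le]; constructor <;> linarith
        nlinarith [abs_nonneg (softmax ε (z t p) i - softmaxBlk ε zs p i)]
      have e3 : |2 * ((softmax ε (z t p) i - softmaxBlk ε zs p i) * softmax ε (z t p) i) * (r - q)|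
          ≤ 2 * D + 1 := by
        rw [abs_mul, abs_mul, abs_of_pos (two_pos : (0:ℝ) < 2)]
        have := mul_le_mul e2 hrq (abs_nonneg _) zero_le_one
        linarith
      rw [← e] at e3
      exact e3
    have hf : Tendsto f atTop (nhds 0) := by
      refine barbalat (fun s => Wf ε γ K a zs (z s) (ξ s)) _ f (2 * D + 1) (by linarith)
        (fun t ht => Wf_deriv hε hγ ha hn U z ξ t (hz t ht) (hξ t ht) zs)
        (fun t _ => by positivity) ?_ (fun t _ => Wf_nonneg hε hγ hK ha hn _ _ _) ?_
      · intro t ht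
        have h1 := Wf_bound hε hK hn U hU_mono (z t) (ξ t) zs
        simp only [hzs, sub_self, mul_zero, Finset.sum_const_zero, zero_sub] at h1
        refine h1.trans (neg_le_neg (mul_le_mul_of_nonneg_left ?_ hε.le))
        refine le_trans ?_ (Finset.single_le_sum
          (f := fun p => ∑ i, (softmaxBlk ε (z t) p i - softmaxBlk ε zs p i) ^ 2)
          (fun p _ => Finset.sum_nonneg fun i _ => sq_nonneg _) (Finset.mem_univ p))
        exact Finset.single_le_sum
          (f := fun i => (softmaxBlk ε (z t) p i - softmaxBlk ε zs p i) ^ 2)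
          (fun i _ => sq_nonneg _) (Finset.mem_univ i)
      · intro s t hs hst
        choose! f' hf1 hf2 using hfd
        have := (convex_Ici (0:ℝ)).norm_image_sub_le_of_norm_hasDerivWithin_le
          (f := f) (f' := f') (C := 2 * D + 1) (fun u hu => (hf1 u hu).hasDerivWithinAt)
          (fun u hu => hf2 u hu) (Set.mem_Ici.2 hs) (Set.mem_Ici.2 (hs.trans hst))
        rwa [Real.norm_eq_abs, Real.norm_eq_abs, abs_of_nonneg (sub_nonneg.2 hst)] at this
    have h2 : Tendsto (fun t => |softmaxBlk ε (z t) p i - softmaxBlk ε zs p i|) atTop (nhds 0) := by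
      have h3 := (Real.continuous_sqrt.tendsto 0).comp (by simpa using hf.const_mul ε⁻¹)
      rw [Real.sqrt_zero] at h3
      refine h3.congr fun t => ?_
      simp only [Function.comp, f]
      rw [inv_mul_cancel_left₀ hε.ne', Real.sqrt_sq_eq_abs]
    rw [tendsto_iff_norm_sub_tendsto_zero]
    exact h2
  have hxlim' : Tendsto (fun t => softmaxBlk ε (z t)) atTop (nhds (softmaxBlk ε zs)) :=
    tendsto_pi_nhds.2 fun p => tendsto_pi_nhds.2 fun i => hxlim p i
  have hξlim : ∀ p i, Tendsto (fun t => ξ t p i) atTop (nhds (-softmaxBlk ε zs p i)) := fun p i =>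
    lin_tendsto a _ ha _ _ (hξd p i) (hxlim p i).neg
  have hUlim : Tendsto (fun t => U (softmaxBlk ε (z t))) atTop (nhds zs) := by
    have h1 := (hUc _ (hmem zs)).tendsto
    rw [hzs] at h1
    exact h1.comp (tendsto_nhdsWithin_iff.2 ⟨hxlim', Eventually.of_forall fun t => hmem _⟩)
  have hzlim : ∀ p i, Tendsto (fun t => z t p i) atTop (nhds (zs p i)) := fun p i => by
    refine lin_tendsto γ _ hγ _ _ (hzd p i) ?_
    have h1 := (tendsto_pi_nhds.1 (tendsto_pi_nhds.1 hUlim p) i).sub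
      (((hξlim p i).add (hxlim p i)).const_mul K)
    simpa using h1
  exact ⟨tendsto_pi_nhds.2 fun p => tendsto_pi_nhds.2 fun i => hzlim p i,
    tendsto_pi_nhds.2 fun p => tendsto_pi_nhds.2 fun i => hξlim p i, hxlim'⟩
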